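/- arXiv:0712.0260 — 3 statements merged into one kernel-verified Lean document; each statement's English description precedes it below -/
import Mathlib

section
/- Let B be a topological space, and let 𝒢 and M be presheaves of abelian groups on B such that M is a right 𝒢-module: for each open U ⊆ B there is a map M(U) × 𝒢(U) → M(U), (φ, g) ↦ φ·g, which is additive in φ, satisfies φ·0 = φ and (φ·g)·h = φ·(g+h), and is compatible with the restriction maps of both presheaves. Fix an open cover U_• = {U_i}_{i∈I} of B and a Čech 1-cocycle g of 𝒢, i.e. elements g_{ij} ∈ 𝒢(U_i ∩ U_j) with g_{ij}|_{U_{ijk}} + g_{jk}|_{U_{ijk}} = g_{ik}|_{U_{ijk}} on all triple intersections. For n ≥ 1 define the twisted coboundary operator δ_g : Čⁿ⁻¹(U_•, M) → Čⁿ(U_•, M) by δ_g φ := δφ + g★φ, where δ is the ordinary Čech coboundary operator and (g★φ)_{i₀…iₙ} := (−1)^{n−1} ( φ_{i₀…i_{n−1}} − φ_{i₀…i_{n−1}}·g_{i_{n−1}iₙ} ), all terms restricted to U_{i₀…iₙ}. Then δ_g ∘ δ_g = 0, i.e. (Č^•(U_•, M), δ_g) is a cochain complex. -/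
/-!
Twisted Čech coboundary operator squares to zero.

`B` is a topological space; `M` and `𝒢` are presheaves of abelian groups on `B`
(given concretely by their sections and restriction maps), and `M` is a right
`𝒢`-module.  Given an open cover `U : I → Opens B` and a Čech 1-cocycle
`gc i j ∈ 𝒢 (U i ⊓ U j)`, the twisted coboundary `δ_g φ = δ φ + g★φ`
satisfies `δ_g ∘ δ_g = 0`.
-/

open TopologicalSpace

namespace Stmt0

/-- A presheaf of abelian groups on `B`, given concretely. -/
structure AbPresheaf (B : Type*) [TopologicalSpace B] where
  obj : Opens B → Type*
  grp : ∀ U, AddCommGroup (obj U)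
  res : ∀ {U V : Opens B}, U ≤ V → obj V →+ obj U
  res_id : ∀ (U : Opens B) (x : obj U), res (le_refl U) x = x
  res_res : ∀ {U V W : Opens B} (h₁ : U ≤ V) (h₂ : V ≤ W) (x : obj W),
    res h₁ (res h₂ x) = res (h₁.trans h₂) x

attribute [instance] AbPresheaf.grp

variable {B : Type*} [TopologicalSpace B]

/-- A right module structure of a presheaf of abelian groups `G` on a presheaf of
abelian groups `M`, compatible with the restriction maps of both presheaves. -/
structure ModuleStr (M G : AbPresheaf B) where
  smul : ∀ {U : Opens B}, M.obj U → G.obj U → M.obj U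
  add_smul' : ∀ {U : Opens B} (φ ψ : M.obj U) (g : G.obj U),
    smul (φ + ψ) g = smul φ g + smul ψ g
  smul_zero' : ∀ {U : Opens B} (φ : M.obj U), smul φ (0 : G.obj U) = φ
  smul_add' : ∀ {U : Opens B} (φ : M.obj U) (g h : G.obj U),
    smul (smul φ g) h = smul φ (g + h)
  res_smul' : ∀ {U V : Opens B} (h : U ≤ V) (φ : M.obj V) (g : G.obj V),
    M.res h (smul φ g) = smul (M.res h φ) (G.res h g)

variable {I : Type*}

/-- Čech `n`-cochains with respect to the cover `U` with values in the presheaf `M`: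
families `φ_{i₀ … iₙ} ∈ M (U_{i₀} ⊓ … ⊓ U_{iₙ})`. -/
abbrev Cochain (M : AbPresheaf B) (U : I → Opens B) (n : ℕ) : Type _ :=
  ∀ f : Fin (n + 1) → I, M.obj (⨅ k, U (f k))

lemma iInf_le_face (U : I → Opens B) {n : ℕ} (f : Fin (n + 2) → I) (i : Fin (n + 2)) :
    (⨅ k, U (f k)) ≤ ⨅ k : Fin (n + 1), U (f (i.succAbove k)) :=
  le_iInf fun k => iInf_le _ (i.succAbove k)

lemma iInf_le_front (U : I → Opens B) {n : ℕ} (f : Fin (n + 2) → I) :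
    (⨅ k, U (f k)) ≤ ⨅ k : Fin (n + 1), U (f k.castSucc) :=
  le_iInf fun k => iInf_le _ k.castSucc

lemma iInf_le_lastPair (U : I → Opens B) {n : ℕ} (f : Fin (n + 2) → I) :
    (⨅ k, U (f k)) ≤ U (f (Fin.last n).castSucc) ⊓ U (f (Fin.last (n + 1))) :=
  le_inf (iInf_le _ _) (iInf_le _ _)

/-- The ordinary Čech coboundary operator. -/
def cb (M : AbPresheaf B) (U : I → Opens B) {n : ℕ}
    (φ : Cochain M U n) : Cochain M U (n + 1) := fun f =>
  ∑ i : Fin (n + 2),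
    (-1 : ℤ) ^ (i : ℕ) • M.res (iInf_le_face U f i) (φ fun k => f (i.succAbove k))

/-- The twisting term `g★φ`:
`(g★φ)_{i₀…i_{n+1}} = (−1)^n (φ_{i₀…iₙ} − φ_{i₀…iₙ} · g_{iₙ i_{n+1}})`,
all terms restricted to the total intersection. -/
def gstar {M G : AbPresheaf B} (A : ModuleStr M G) (U : I → Opens B)
    (gc : ∀ i j : I, G.obj (U i ⊓ U j)) {n : ℕ}
    (φ : Cochain M U n) : Cochain M U (n + 1) := fun f =>
  (-1 : ℤ) ^ n •
    (M.res (iInf_le_front U f) (φ fun k => f k.castSucc) -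
      A.smul (M.res (iInf_le_front U f) (φ fun k => f k.castSucc))
        (G.res (iInf_le_lastPair U f) (gc (f (Fin.last n).castSucc) (f (Fin.last (n + 1))))))

/-- The twisted Čech coboundary operator `δ_g φ := δ φ + g★φ`. -/
def cbG {M G : AbPresheaf B} (A : ModuleStr M G) (U : I → Opens B)
    (gc : ∀ i j : I, G.obj (U i ⊓ U j)) {n : ℕ}
    (φ : Cochain M U n) : Cochain M U (n + 1) := fun f =>
  cb M U φ f + gstar A U gc φ f

/-- The action of a fixed section of `G`, as an additive endomorphism of the sections of `M`. -/
def ModuleStr.actHom {M G : AbPresheaf B} (A : ModuleStr M G) {V : Opens B} (g : G.obj V) :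
    M.obj V →+ M.obj V :=
  AddMonoidHom.mk' (fun m => A.smul m g) fun m m' => A.add_smul' m m' g

lemma ModuleStr.actHom_apply {M G : AbPresheaf B} (A : ModuleStr M G) {V : Opens B}
    (g : G.obj V) (m : M.obj V) : A.actHom g m = A.smul m g := rfl

lemma Cochain.res_congr {M : AbPresheaf B} {U : I → Opens B} {n : ℕ} (φ : Cochain M U n)
    {V : Opens B} {f f' : Fin (n + 1) → I} (hf : f = f') (h : V ≤ ⨅ k, U (f k))
    (h' : V ≤ ⨅ k, U (f' k)) : M.res h (φ f) = M.res h' (φ f') := by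
  subst hf; rfl

lemma res_pair_congr {G : AbPresheaf B} {U : I → Opens B} (gc : ∀ i j : I, G.obj (U i ⊓ U j))
    {V : Opens B} {i i' j j' : I} (hi : i = i') (hj : j = j') (h : V ≤ U i ⊓ U j)
    (h' : V ≤ U i' ⊓ U j') : G.res h (gc i j) = G.res h' (gc i' j') := by
  subst hi hj; rfl

/-- The section of `G` twisting the `i`-th face: the cochain `gc` on the last two indices
for the last face, and zero for the other faces. -/
def faceTwist {G : AbPresheaf B} (U : I → Opens B) (gc : ∀ i j : I, G.obj (U i ⊓ U j)) {n : ℕ}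
    (f : Fin (n + 2) → I) (i : Fin (n + 2)) : G.obj (⨅ k, U (f k)) :=
  if i = Fin.last (n + 1) then
    G.res (iInf_le_lastPair U f) (gc (f (Fin.last n).castSucc) (f (Fin.last (n + 1))))
  else 0

/-- The twisted coboundary is the alternating sum of the twisted faces. -/
lemma cbG_eq_sum {M G : AbPresheaf B} (A : ModuleStr M G) (U : I → Opens B)
    (gc : ∀ i j : I, G.obj (U i ⊓ U j)) {n : ℕ} (φ : Cochain M U n) (f : Fin (n + 2) → I) :
    cbG A U gc φ f = ∑ i : Fin (n + 2), (-1 : ℤ) ^ (i : ℕ) •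
      A.smul (M.res (iInf_le_face U f i) (φ fun k => f (i.succAbove k))) (faceTwist U gc f i) := by
  have hlast : M.res (iInf_le_face U f (Fin.last (n + 1)))
      (φ fun k => f ((Fin.last (n + 1)).succAbove k)) =
      M.res (iInf_le_front U f) (φ fun k => f k.castSucc) :=
    φ.res_congr (by simp) _ _
  simp only [cbG, cb, gstar]
  rw [Fin.sum_univ_castSucc (n := n + 1), Fin.sum_univ_castSucc (n := n + 1), hlast,
    add_assoc (Finset.sum _ _)]
  congr 1
  · refine Finset.sum_congr rfl fun i _ => ?_
    rw [faceTwist, if_neg (Fin.castSucc_lt_last i).ne, A.smul_zero']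
  · rw [faceTwist, if_pos rfl, Fin.val_last, pow_succ, mul_neg_one, neg_smul, neg_smul, smul_sub]
    abel

/-- An alternating double sum over iterated faces vanishes if its terms satisfy the
simplicial identities. -/
lemma sum_alternating_eq_zero {X : Type*} [AddCommGroup X] {n : ℕ}
    (a : Fin (n + 2) → Fin (n + 1) → X)
    (ha : ∀ i j : Fin (n + 1), i ≤ j → a j.succ i = a i.castSucc j) :
    ∑ i : Fin (n + 2), ∑ j : Fin (n + 1), ((-1 : ℤ) ^ (i : ℕ) * (-1 : ℤ) ^ (j : ℕ)) • a i j = 0 := by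
  rw [← Fintype.sum_prod_type'
    (f := fun (i : Fin (n + 2)) (j : Fin (n + 1)) => ((-1 : ℤ) ^ (i : ℕ) * (-1 : ℤ) ^ (j : ℕ)) • a i j)]
  rw [← Finset.sum_filter_add_sum_filter_not _
    (fun p : Fin (n + 2) × Fin (n + 1) => p.2.castSucc < p.1), add_eq_zero_iff_eq_neg,
    ← Finset.sum_neg_distrib]
  refine Finset.sum_bij'
    (fun p hp => (p.2.castSucc, p.1.pred (Fin.ne_zero_of_lt (Finset.mem_filter.1 hp).2)))
    (fun p hp => (p.2.succ, p.1.castPred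
      (ne_of_lt (lt_of_le_of_lt (not_lt.1 (Finset.mem_filter.1 hp).2) (Fin.castSucc_lt_last _)))))
    ?_ ?_ ?_ ?_ ?_
  · rintro ⟨i, j⟩ hp
    simp only [Finset.mem_filter, Finset.mem_univ, true_and, Fin.lt_def, Fin.val_castSucc,
      Fin.val_pred] at hp ⊢
    omega
  · rintro ⟨i, j⟩ hp
    simp only [Finset.mem_filter, Finset.mem_univ, true_and, Fin.lt_def, Fin.val_castSucc,
      Fin.val_succ, Fin.coe_castPred] at hp ⊢
    omega
  · rintro ⟨i, j⟩ hp
    simp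
  · rintro ⟨i, j⟩ hp
    simp
  · rintro ⟨i, j⟩ hp
    have hlt : j.castSucc < i := (Finset.mem_filter.1 hp).2
    obtain ⟨i, rfl⟩ := Fin.exists_succ_eq.2 (Fin.ne_zero_of_lt hlt)
    have hle : j ≤ i := Fin.castSucc_lt_succ_iff.1 hlt
    simp only [Fin.pred_succ, Fin.val_succ, Fin.val_castSucc, ha j i hle, ← neg_smul]
    congr 1
    ring

/-- The cocycle condition for `gc`, restricted to a smaller open set. -/
lemma res_add_res_of_cocycle {G : AbPresheaf B} {U : I → Opens B}
    {gc : ∀ i j : I, G.obj (U i ⊓ U j)}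
    (hcoc : ∀ i j k : I,
      G.res (inf_le_left : U i ⊓ U j ⊓ U k ≤ U i ⊓ U j) (gc i j) +
        G.res (le_inf (inf_le_left.trans inf_le_right) inf_le_right :
          U i ⊓ U j ⊓ U k ≤ U j ⊓ U k) (gc j k) =
      G.res (le_inf (inf_le_left.trans inf_le_left) inf_le_right :
          U i ⊓ U j ⊓ U k ≤ U i ⊓ U k) (gc i k))
    {V : Opens B} {i j k : I} (hij : V ≤ U i ⊓ U j) (hjk : V ≤ U j ⊓ U k)
    (hik : V ≤ U i ⊓ U k) :
    G.res hij (gc i j) + G.res hjk (gc j k) = G.res hik (gc i k) := by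
  have := congrArg (G.res (le_inf hij (hjk.trans inf_le_right) : V ≤ U i ⊓ U j ⊓ U k))
    (hcoc i j k)
  simpa only [map_add, G.res_res] using this

/-- The twists of iterated faces satisfy the simplicial identities. -/
lemma faceTwist_face {G : AbPresheaf B} {U : I → Opens B}
    {gc : ∀ i j : I, G.obj (U i ⊓ U j)}
    (hcoc : ∀ i j k : I,
      G.res (inf_le_left : U i ⊓ U j ⊓ U k ≤ U i ⊓ U j) (gc i j) +
        G.res (le_inf (inf_le_left.trans inf_le_right) inf_le_right :
          U i ⊓ U j ⊓ U k ≤ U j ⊓ U k) (gc j k) =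
      G.res (le_inf (inf_le_left.trans inf_le_left) inf_le_right :
          U i ⊓ U j ⊓ U k ≤ U i ⊓ U k) (gc i k))
    {n : ℕ} (f : Fin (n + 3) → I) {i j : Fin (n + 2)} (hij : i ≤ j) :
    G.res (iInf_le_face U f j.succ) (faceTwist U gc (fun k => f (j.succ.succAbove k)) i) +
        faceTwist U gc f j.succ =
      G.res (iInf_le_face U f i.castSucc)
          (faceTwist U gc (fun k => f (i.castSucc.succAbove k)) j) +
        faceTwist U gc f i.castSucc := by
  have hi : i.castSucc ≠ Fin.last (n + 2) := (Fin.castSucc_lt_last i).ne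
  rcases eq_or_ne j (Fin.last (n + 1)) with rfl | hj
  · simp only [faceTwist, if_neg hi, Fin.succ_last, if_true, add_zero, G.res_res]
    rcases eq_or_ne i (Fin.last (n + 1)) with rfl | hi'
    · rw [if_pos rfl, G.res_res]
      have hlast : ∀ k : Fin (n + 2), (Fin.last (n + 2)).succAbove k = k.castSucc := by simp
      have h₁ : (Fin.last (n + 1)).castSucc.succAbove (Fin.last n).castSucc =
          (Fin.last n).castSucc.castSucc := by
        simp [Fin.succAbove, Fin.lt_def]
      have h₂ : (Fin.last (n + 1)).castSucc.succAbove (Fin.last (n + 1)) =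
          Fin.last (n + 2) := by
        simp [Fin.succAbove]
      have hle : ∀ a b : Fin (n + 3), (⨅ k, U (f k)) ≤ U (f a) ⊓ U (f b) :=
        fun a b => le_inf (iInf_le _ _) (iInf_le _ _)
      rw [res_pair_congr gc (congrArg f (hlast _)) (congrArg f (hlast _)) _ (hle _ _),
        res_pair_congr gc (congrArg f h₁) (congrArg f h₂) _ (hle _ _)]
      exact res_add_res_of_cocycle hcoc _ _ _
    · rw [if_neg hi', map_zero, zero_add]
      have hlt : (i : ℕ) < n + 1 := Fin.val_lt_last hi'
      refine res_pair_congr gc (congrArg f ?_) (congrArg f ?_) _ _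
      · simp only [Fin.ext_iff, Fin.succAbove, Fin.lt_def, Fin.val_castSucc, Fin.val_last]
        rw [if_neg (by omega)]
        simp
      · simp only [Fin.ext_iff, Fin.succAbove, Fin.lt_def, Fin.val_castSucc, Fin.val_last]
        rw [if_neg (by omega)]
        simp
  · have hi' : i ≠ Fin.last (n + 1) := (hij.trans_lt (Fin.lt_last_iff_ne_last.2 hj)).ne
    have hj' : j.succ ≠ Fin.last (n + 2) := by
      rwa [← Fin.succ_last, Ne, Fin.succ_inj]
    simp only [faceTwist, if_neg hi, if_neg hi', if_neg hj, if_neg hj', map_zero]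

/-- If `gc` is a Čech 1-cocycle of `G`, then the twisted coboundary operator `δ_g`
squares to zero, i.e. `(Č^•(U_•, M), δ_g)` is a cochain complex. -/
theorem twisted_coboundary_sq_zero
    (M G : AbPresheaf B) (A : ModuleStr M G) (U : I → Opens B)
    (gc : ∀ i j : I, G.obj (U i ⊓ U j))
    (hcoc : ∀ i j k : I,
      G.res (inf_le_left : U i ⊓ U j ⊓ U k ≤ U i ⊓ U j) (gc i j) +
        G.res (le_inf (inf_le_left.trans inf_le_right) inf_le_right :
          U i ⊓ U j ⊓ U k ≤ U j ⊓ U k) (gc j k) =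
      G.res (le_inf (inf_le_left.trans inf_le_left) inf_le_right :
          U i ⊓ U j ⊓ U k ≤ U i ⊓ U k) (gc i k))
    {n : ℕ} (φ : Cochain M U n) (f : Fin (n + 3) → I) :
    cbG A U gc (cbG A U gc φ) f = 0 := by
  simp only [cbG_eq_sum, ← A.actHom_apply, map_sum, map_zsmul, Finset.smul_sum, smul_smul]
  refine sum_alternating_eq_zero (fun i j => A.actHom (faceTwist U gc f i)
    (M.res (iInf_le_face U f i) (A.actHom (faceTwist U gc (fun k => f (i.succAbove k)) j)
      (M.res (iInf_le_face U (fun k => f (i.succAbove k)) j)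
        (φ fun k => f (i.succAbove (j.succAbove k))))))) fun i j hij => ?_
  simp only [A.actHom_apply, A.res_smul', A.smul_add', M.res_res, faceTwist_face hcoc f hij]
  congr 1
  refine φ.res_congr (funext fun k => congrArg f ?_) _ _
  simp only [Fin.ext_iff, Fin.succAbove, Fin.lt_def, Fin.le_def] at hij ⊢
  split_ifs <;> simp_all <;> omega

end Stmt0
end

section
/- The space Z¹_cont(ℝⁿ, Map(𝕋ⁿ, U(1))) of continuous U(1)-valued cocycles is a contractible topological space. -/
/-!
The space `Z¹_cont(ℝⁿ, Map(𝕋ⁿ, U(1)))` of continuous `U(1)`-valued cocycles is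
contractible.
-/

noncomputable section

/-- The `n`-torus `𝕋ⁿ = ℝⁿ/ℤⁿ`. -/
abbrev Torus (n : ℕ) : Type := Fin n → AddCircle (1 : ℝ)

/-- The quotient homomorphism `p : ℝⁿ → 𝕋ⁿ`. -/
def torusProj (n : ℕ) : (Fin n → ℝ) → Torus n := fun v i => (v i : AddCircle (1 : ℝ))

/-- The space `Z¹_cont(ℝⁿ, Map(𝕋ⁿ, U(1)))` of continuous `U(1)`-valued cocycles,
with the subspace topology inherited from the compact-open topology on
`C(ℝⁿ, C(𝕋ⁿ, U(1)))`. -/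
abbrev CocycleU1 (n : ℕ) : Type :=
  {α : C(Fin n → ℝ, C(Torus n, Circle)) //
    ∀ (g h : Fin n → ℝ) (z : Torus n),
      α (g + h) z = α g (z + torusProj n h) * α h z}

theorem continuous_torusProj (n : ℕ) : Continuous (torusProj n) :=
  continuous_pi fun i => (AddCircle.continuous_mk' (1 : ℝ)).comp (continuous_apply i)

theorem torusProj_zero (n : ℕ) : torusProj n 0 = 0 := by
  ext i
  simp [torusProj]

theorem CocycleU1.apply_zero {n : ℕ} (α : CocycleU1 n) (z : Torus n) : α.1 0 z = 1 := by
  have h := α.2 0 0 z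
  rw [torusProj_zero, add_zero, add_zero] at h
  exact mul_eq_left.mp h.symm

/-- The value of a cocycle has a real logarithm that depends jointly continuously on the cocycle
and on its arguments and vanishes at `0`. -/
theorem CocycleU1.exists_continuous_log (n : ℕ) :
    ∃ a : C(CocycleU1 n × (Fin n → ℝ) × Torus n, ℝ),
      (∀ α g z, Circle.exp (a (α, g, z)) = α.1 g z) ∧ ∀ α z, a (α, 0, z) = 0 := by
  let F : C(unitInterval × (CocycleU1 n × (Fin n → ℝ) × Torus n), Circle) :=
    { toFun := fun q => q.2.1.1 ((q.1 : ℝ) • q.2.2.1) q.2.2.2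
      continuous_toFun := by fun_prop }
  have hF (y : CocycleU1 n × (Fin n → ℝ) × Torus n) :
      F (0, y) = Circle.exp ((ContinuousMap.const _ (0 : ℝ)) y) := by
    simp [F, CocycleU1.apply_zero]
  let L := Circle.isCoveringMap_exp.liftHomotopy F (ContinuousMap.const _ 0) hF
  have hL (y : CocycleU1 n × (Fin n → ℝ) × Torus n) :
      Circle.exp (L (1, y)) = y.1.1 y.2.1 y.2.2 := by
    have h := congr_fun
      (Circle.isCoveringMap_exp.liftHomotopy_lifts F (ContinuousMap.const _ 0) hF) (1, y)
    exact h.trans (by simp [F])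
  refine ⟨⟨fun y => L (1, y) - L (1, y.1, 0, y.2.2), by fun_prop⟩, fun α g z => ?_, fun α z => ?_⟩
  · simp [Circle.exp_sub, hL, CocycleU1.apply_zero]
  · simp

/-- A continuous logarithm vanishing at `0` of a `U(1)`-valued cocycle is a real cocycle. -/
theorem CocycleU1.log_add {n : ℕ} (α : CocycleU1 n) (a : C((Fin n → ℝ) × Torus n, ℝ))
    (ha : ∀ g z, Circle.exp (a (g, z)) = α.1 g z) (ha_zero : ∀ z, a (0, z) = 0)
    (g h : Fin n → ℝ) (z : Torus n) :
    a (g + h, z) = a (g, z + torusProj n h) + a (h, z) := by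
  have hp := continuous_torusProj n
  have key := Circle.isCoveringMap_exp.const_of_comp (A := ℝ)
    (g := fun t => a (t • g + t • h, z) - (a (t • g, z + torusProj n (t • h)) + a (t • h, z)))
    (by fun_prop)
    (fun s t => by simp [Circle.exp_sub, Circle.exp_add, ha, α.2]) 1 0
  simpa [ha_zero, torusProj_zero, sub_eq_zero] using key

/-- The space of continuous `U(1)`-valued cocycles is contractible. -/
theorem cocycleU1_contractible (n : ℕ) : ContractibleSpace (CocycleU1 n) := by
  obtain ⟨a, ha, ha_zero⟩ := CocycleU1.exists_continuous_log n
  let H : C(((unitInterval × CocycleU1 n) × (Fin n → ℝ)) × Torus n, Circle) :=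
    { toFun := fun q => Circle.exp ((1 - (q.1.1.1 : ℝ)) * a (q.1.1.2, q.1.2, q.2))
      continuous_toFun := by fun_prop }
  have a_add (α : CocycleU1 n) (g h : Fin n → ℝ) (z : Torus n) :
      a (α, g + h, z) = a (α, g, z + torusProj n h) + a (α, h, z) :=
    α.log_add (a.comp ⟨fun y => (α, y), by fun_prop⟩) (ha α) (ha_zero α) g h z
  let trivialCocycle : CocycleU1 n := ⟨1, fun g h z => by simp⟩
  refine (contractible_iff_id_nullhomotopic _).mpr ⟨trivialCocycle, ⟨?_⟩⟩
  exact
    { toFun := fun q => ⟨H.curry.curry q, fun g h z => by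
        simp [H, a_add, mul_add, Circle.exp_add]⟩
      continuous_toFun := H.curry.curry.continuous.subtype_mk _
      map_zero_left := fun α => by
        ext g z
        simp [H, ha]
      map_one_left := fun α => by
        ext g z
        simp [H, trivialCocycle] }
end
end

section
/- Let Z be a topological space and let p : Σ → Z be the canonical continuous map from the topological disjoint union Σ of the path components of Z (each path component carrying the subspace topology, and Σ the disjoint-union/sigma topology) to Z. Then p has the homotopy lifting property with respect to every topological space: for every topological space X, every continuous map h : X × [0,1] → Z, and every continuous map h₀ : X → Σ with p ∘ h₀ = h(·, 0), there exists a (necessarily unique) continuous map h̃ : X × [0,1] → Σ with p ∘ h̃ = h and h̃(·, 0) = h₀. -/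
/-!
The canonical continuous bijection from the topological disjoint union of the
path components of a space `Z` to `Z` has the homotopy lifting property with
respect to every topological space.
-/

/-- The topological disjoint union of the path components of `Z`: the sigma
type over the set of path components (the quotient of `Z` by the "joined by a
path" relation), each path component carrying the subspace topology and the
total space the disjoint-union (sigma) topology. -/
abbrev PathComponentsSigma (Z : Type*) [TopologicalSpace Z] : Type _ :=
  Σ c : Quotient (pathSetoid Z), {z : Z // Quotient.mk (pathSetoid Z) z = c}

/-- The canonical continuous map from the disjoint union of the path
components of `Z` to `Z`. -/
def pathComponentsProj (Z : Type*) [TopologicalSpace Z] :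
    PathComponentsSigma Z → Z := fun x => x.2.1

theorem pathComponentsProj_injective (Z : Type*) [TopologicalSpace Z] :
    Function.Injective (pathComponentsProj Z) := by
  rintro ⟨c, z, rfl⟩ ⟨d, w, rfl⟩ hzw
  obtain rfl : z = w := hzw
  rfl

theorem mk_pathComponentsProj {Z : Type*} [TopologicalSpace Z] (s : PathComponentsSigma Z) :
    Quotient.mk (pathSetoid Z) (pathComponentsProj Z s) = s.1 :=
  s.2.2

/-- A map into the disjoint union of the path components is continuous as soon as its
projection to `Z` is continuous and its component index is locally constant. -/
theorem continuous_of_isLocallyConstant_fst {Y Z : Type*} [TopologicalSpace Y]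
    [TopologicalSpace Z] {f : Y → PathComponentsSigma Z}
    (hf : Continuous fun y => pathComponentsProj Z (f y))
    (hc : IsLocallyConstant fun y => (f y).1) : Continuous f := by
  refine continuous_def.2 fun U hU => ?_
  choose V hV hVU using fun c => isOpen_induced_iff.1 (isOpen_sigma_iff.1 hU c)
  have key : ∀ s : PathComponentsSigma Z, pathComponentsProj Z s ∈ V s.1 ↔ s ∈ U :=
    fun s => Set.ext_iff.1 (hVU s.1) s.2
  have hpre : f ⁻¹' U = ⋃ c, (fun y => (f y).1) ⁻¹' {c} ∩
      (fun y => pathComponentsProj Z (f y)) ⁻¹' V c := by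
    ext y
    simp [← key]
  rw [hpre]
  exact isOpen_iUnion fun c => (hc {c}).inter ((hV c).preimage hf)

theorem pathComponentsSigma_homotopy_lifting
    {Z : Type*} [TopologicalSpace Z] (X : Type*) [TopologicalSpace X]
    (h : X × unitInterval → Z) (hh : Continuous h)
    (h₀ : X → PathComponentsSigma Z) (hh₀ : Continuous h₀)
    (hlift₀ : ∀ x : X, pathComponentsProj Z (h₀ x) = h (x, 0)) :
    ∃! ht : X × unitInterval → PathComponentsSigma Z,
      Continuous ht ∧
      (∀ p : X × unitInterval, pathComponentsProj Z (ht p) = h p) ∧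
      (∀ x : X, ht (x, 0) = h₀ x) := by
  have hcomp (p : X × unitInterval) : Quotient.mk (pathSetoid Z) (h p) = (h₀ p.1).1 := by
    rw [← mk_pathComponentsProj, hlift₀]
    have : PathConnectedSpace unitInterval := isPathConnected_iff_pathConnectedSpace.1
      ((convex_Icc (0 : ℝ) 1).isPathConnected (Set.nonempty_Icc.2 zero_le_one))
    obtain ⟨γ⟩ := PathConnectedSpace.joined p.2 (0 : unitInterval)
    exact Quotient.sound ⟨γ.map (f := fun t => h (p.1, t)) (by fun_prop)⟩
  refine ⟨fun p => ⟨(h₀ p.1).1, h p, hcomp p⟩, ⟨?_, fun _ => rfl, fun x => ?_⟩, ?_⟩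
  · refine continuous_of_isLocallyConstant_fst hh fun s => ?_
    have hopen : IsOpen (Sigma.fst ⁻¹' s : Set (PathComponentsSigma Z)) :=
      isOpen_sigma_iff.2 fun c => isOpen_const (p := c ∈ s)
    exact hopen.preimage (hh₀.comp continuous_fst)
  · exact pathComponentsProj_injective Z (hlift₀ x).symm
  · rintro g ⟨-, hg, -⟩
    exact funext fun p => pathComponentsProj_injective Z (hg p)
end
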